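/- Local optimum quality bound: Assume OPT = max_{S⊆X} f(S) = 1 for nonnegative submodular f with multilinear extension F. Let q ∈ [1/3, 1/(1+√2)], p = 1-q, and let A ⊆ X satisfy F(x_p(A Δ {i})) ≤ F(x_p(A)) for all i, with β = max(f(A), f(X\A)). Then F(x_p(A)) ≥ (1-q²)/2 - q(1-2q)·β. -/

import Mathlib

def Submodular {X : Type*} [DecidableEq X] (f : Finset X → ℝ) : Prop :=
  ∀ S T : Finset X, f (S ∪ T) + f (S ∩ T) ≤ f S + f T

/-- The multilinear extension of a set function. -/
def mExt {X : Type*} [Fintype X] [DecidableEq X] (f : Finset X → ℝ) (x : X → ℝ) : ℝ :=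
  ∑ S : Finset X, f S * ((∏ i ∈ S, x i) * ∏ j ∈ Sᶜ, (1 - x j))

/-- The vector `x_p(A)` with coordinate `p` on `A` and `1-p` off `A`. -/
def xp {X : Type*} [DecidableEq X] (p : ℝ) (A : Finset X) : X → ℝ :=
  fun i => if i ∈ A then p else 1 - p

section MultilinearExtension

open Finset Function

variable {X : Type*} [DecidableEq X]

lemma Submodular.comp_insert {f : Finset X → ℝ} (hf : Submodular f) (i : X) :
    Submodular (fun S => f (insert i S)) := fun S T => by
  simpa only [insert_union_distrib, insert_inter_distrib] using hf (insert i S) (insert i T)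

lemma Submodular.comp_erase {f : Finset X → ℝ} (hf : Submodular f) (i : X) :
    Submodular (fun S => f (S.erase i)) := fun S T => by
  have h := hf (S.erase i) (T.erase i)
  rwa [← erase_union_distrib, erase_inter, inter_erase, erase_idem] at h

lemma Submodular.comp_union {f : Finset X → ℝ} (hf : Submodular f) (D : Finset X) :
    Submodular (fun S => f (S ∪ D)) := fun S T => by
  have h := hf (S ∪ D) (T ∪ D)
  rwa [← union_union_distrib_right, ← inter_union_distrib_right] at h

lemma xp_symmDiff_singleton (p : ℝ) (A : Finset X) (i : X) :
    xp p (symmDiff A {i}) = update (xp p A) i (1 - xp p A i) := by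
  ext j
  by_cases hj : j = i
  · subst hj
    by_cases hA : j ∈ A <;> simp [xp, mem_symmDiff, hA]
  · simp [xp, mem_symmDiff, hj]

lemma piecewise_const_mem_Icc {x : X → ℝ} (hx : ∀ i, x i ∈ Set.Icc (0 : ℝ) 1) {t : ℝ}
    (ht : t ∈ Set.Icc (0 : ℝ) 1) (D : Finset X) (i : X) :
    D.piecewise (fun _ => t) x i ∈ Set.Icc (0 : ℝ) 1 := by
  by_cases hi : i ∈ D <;> simp only [hi, piecewise_eq_of_mem, piecewise_eq_of_notMem,
    not_false_eq_true, ht, hx i]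

/-- The four-block inequality behind the bound: `S₁`, `S₂` are the parts of the local optimum
outside and inside the global optimum, `S₃`, `S₄` those of its complement. -/
lemma Submodular.four_blocks_bound {f : Finset X → ℝ} (hf0 : ∀ S, 0 ≤ f S) (hf : Submodular f)
    {S₁ S₂ S₃ S₄ : Finset X} (h₁₂ : Disjoint S₁ S₂) (h₁₃ : Disjoint S₁ S₃)
    (h₁₄ : Disjoint S₁ S₄) (h₂₃ : Disjoint S₂ S₃) (h₂₄ : Disjoint S₂ S₄) (h₃₄ : Disjoint S₃ S₄)
    {q : ℝ} (hq : 1 / 3 ≤ q) (hq' : q ^ 2 + 2 * q ≤ 1) :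
    (1 - q ^ 2) * f (S₂ ∪ S₄) ≤
      (q * ((1 - q) * ((1 - q) * f (S₁ ∪ S₂ ∪ S₃ ∪ S₄) + q * f (S₂ ∪ S₃ ∪ S₄)) +
          q * ((1 - q) * f (S₁ ∪ S₃ ∪ S₄) + q * f (S₃ ∪ S₄))) +
        (1 - q) * ((1 - q) * ((1 - q) * f (S₁ ∪ S₂ ∪ S₄) + q * f (S₂ ∪ S₄)) +
          q * ((1 - q) * f (S₁ ∪ S₄) + q * f S₄))) +
      (q * (q * ((1 - q) * f (S₂ ∪ S₃ ∪ S₄) + q * f (S₃ ∪ S₄)) +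
          (1 - q) * ((1 - q) * f (S₂ ∪ S₄) + q * f S₄)) +
        (1 - q) * (q * ((1 - q) * f (S₂ ∪ S₃) + q * f S₃) +
          (1 - q) * ((1 - q) * f S₂ + q * f ∅))) +
      2 * (q * (1 - 2 * q) * max (f (S₁ ∪ S₂)) (f (S₃ ∪ S₄))) := by
  rw [disjoint_left] at h₁₂ h₁₃ h₁₄ h₂₃ h₂₄ h₃₄
  have hq1 : q < 1 / 2 := by nlinarith
  have cross : ∀ {S T U I : Finset X}, S ∪ T = U → S ∩ T = I → f U + f I ≤ f S + f T := by
    rintro S T _ _ rfl rfl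
    exact hf S T
  have e₁ : f (S₁ ∪ S₃ ∪ S₄) + f S₄ ≤ f (S₁ ∪ S₄) + f (S₃ ∪ S₄) :=
    cross (by grind) (by grind)
  have e₂ : f (S₂ ∪ S₃ ∪ S₄) + f S₃ ≤ f (S₂ ∪ S₃) + f (S₃ ∪ S₄) :=
    cross (by grind) (by grind)
  have e₃ : f (S₁ ∪ S₂ ∪ S₄) + f S₁ ≤ f (S₁ ∪ S₄) + f (S₁ ∪ S₂) :=
    cross (by grind) (by grind)
  have e₄ : f (S₁ ∪ S₂ ∪ S₃) + f S₂ ≤ f (S₂ ∪ S₃) + f (S₁ ∪ S₂) :=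
    cross (by grind) (by grind)
  have e₅ : f (S₂ ∪ S₄) + f ∅ ≤ f S₂ + f S₄ :=
    cross (by grind) (by grind)
  have e₆ : f (S₁ ∪ S₂ ∪ S₃ ∪ S₄) + f (S₂ ∪ S₄) ≤ f (S₁ ∪ S₂ ∪ S₄) + f (S₂ ∪ S₃ ∪ S₄) :=
    cross (by grind) (by grind)
  obtain ⟨s, hs⟩ : ∃ s, s = (1 - q) * (3 * q - 1) / 2 := ⟨_, rfl⟩
  obtain ⟨r, hr⟩ : ∃ r, r = (1 - q) ^ 2 * q - s := ⟨_, rfl⟩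
  obtain ⟨d, hd⟩ : ∃ d, d = (1 - q) * (1 - q + 2 * q ^ 2) / 2 := ⟨_, rfl⟩
  have hs0 : 0 ≤ s := by rw [hs]; nlinarith
  have hsq : s ≤ q * (1 - 2 * q) := by rw [hs]; nlinarith
  have hr0 : 0 ≤ r := by
    have : 0 ≤ q ^ 3 := by positivity
    rw [hr]
    nlinarith
  have hd0 : 0 ≤ d := by rw [hd]; nlinarith [mul_nonneg (sub_nonneg.2 hq) (sub_nonneg.2 hq)]
  have hA := mul_le_mul_of_nonneg_left (le_max_left (f (S₁ ∪ S₂)) (f (S₃ ∪ S₄)))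
    (mul_nonneg zero_le_two hs0)
  have hB := mul_le_mul_of_nonneg_left (le_max_right (f (S₁ ∪ S₂)) (f (S₃ ∪ S₄)))
    (mul_nonneg zero_le_two (sub_nonneg.2 hsq))
  have m₁ := mul_le_mul_of_nonneg_left e₁ hr0
  have m₂ := mul_le_mul_of_nonneg_left e₂ hr0
  have m₃ := mul_le_mul_of_nonneg_left e₃ hs0
  have m₄ := mul_le_mul_of_nonneg_left e₄ hs0
  have m₅ := mul_le_mul_of_nonneg_left e₅ hd0
  have m₆ := mul_le_mul_of_nonneg_left e₆ hd0
  have hp0 : 0 ≤ 1 - q := by linarith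
  have hq0 : 0 ≤ q := by linarith
  have hX : 0 ≤ (q * (1 - q) ^ 2 + d) * f (S₁ ∪ S₂ ∪ S₃ ∪ S₄) :=
    mul_nonneg (by positivity) (hf0 _)
  have h0 : 0 ≤ (q * (1 - q) ^ 2 + d) * f ∅ := mul_nonneg (by positivity) (hf0 _)
  have h134 : 0 ≤ (q ^ 2 * (1 - q) + r) * f (S₁ ∪ S₃ ∪ S₄) := mul_nonneg (by positivity) (hf0 _)
  have h3 : 0 ≤ (q ^ 2 * (1 - q) + r) * f S₃ := mul_nonneg (by positivity) (hf0 _)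
  have h1 : 0 ≤ s * f S₁ := mul_nonneg hs0 (hf0 _)
  have h123 : 0 ≤ s * f (S₁ ∪ S₂ ∪ S₃) := mul_nonneg hs0 (hf0 _)
  subst hr hd hs
  linarith
variable [Fintype X]

lemma mExt_add (f g : Finset X → ℝ) (x : X → ℝ) :
    mExt (fun S => f S + g S) x = mExt f x + mExt g x := by
  simp only [mExt, add_mul, sum_add_distrib]

lemma mExt_le_mExt {f g : Finset X → ℝ} (h : ∀ S, f S ≤ g S) {x : X → ℝ}
    (hx : ∀ i, x i ∈ Set.Icc (0 : ℝ) 1) : mExt f x ≤ mExt g x := by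
  refine sum_le_sum fun S _ => mul_le_mul_of_nonneg_right (h S) (mul_nonneg ?_ ?_)
  · exact prod_nonneg fun i _ => (hx i).1
  · exact prod_nonneg fun i _ => sub_nonneg.2 (hx i).2

lemma mExt_zero (f : Finset X → ℝ) : mExt f 0 = f ∅ := by
  rw [mExt, sum_eq_single ∅]
  · simp
  · intro S _ hS
    obtain ⟨i, hi⟩ := nonempty_iff_ne_empty.2 hS
    rw [prod_eq_zero hi rfl]
    simp
  · simp

/-- Conditioning the multilinear extension on whether `i` belongs to the random set. -/
lemma mExt_eq_sum_erase (f : Finset X → ℝ) (x : X → ℝ) (i : X) :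
    mExt f x = ∑ S ∈ (univ.erase i).powerset,
      (x i * f (insert i S) + (1 - x i) * f S) *
        ((∏ j ∈ S, x j) * ∏ j ∈ (insert i S)ᶜ, (1 - x j)) := by
  have huniv : (univ : Finset (Finset X)) = (insert i (univ.erase i)).powerset := by
    rw [insert_erase (mem_univ i), powerset_univ]
  rw [mExt, huniv, sum_powerset_insert (notMem_erase i univ), ← sum_add_distrib]
  refine sum_congr rfl fun S hS => ?_
  have hi : i ∉ S := fun h => notMem_erase i univ (mem_powerset.1 hS h)
  have hc : Sᶜ = insert i (insert i S)ᶜ := by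
    ext j
    by_cases hj : j = i <;> simp [hj, hi]
  rw [prod_insert hi, hc, prod_insert (by simp)]
  ring

lemma mExt_update (f : Finset X → ℝ) (x : X → ℝ) (i : X) (t : ℝ) :
    mExt f (update x i t) =
      t * mExt (fun S => f (insert i S)) x + (1 - t) * mExt (fun S => f (S.erase i)) x := by
  rw [mExt_eq_sum_erase f _ i, mExt_eq_sum_erase _ x i, mExt_eq_sum_erase _ x i, mul_sum, mul_sum,
    ← sum_add_distrib]
  refine sum_congr rfl fun S hS => ?_
  have hi : i ∉ S := fun h => notMem_erase i univ (mem_powerset.1 hS h)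
  have hprod : ∏ j ∈ S, update x i t j = ∏ j ∈ S, x j :=
    prod_congr rfl fun j hj => update_of_ne (ne_of_mem_of_not_mem hj hi) _ _
  have hprodc : ∏ j ∈ (insert i S)ᶜ, (1 - update x i t j) = ∏ j ∈ (insert i S)ᶜ, (1 - x j) := by
    refine prod_congr rfl fun j hj => ?_
    rw [update_of_ne]
    rintro rfl
    simp at hj
  rw [hprod, hprodc]
  simp only [update_self, insert_idem, erase_insert hi, erase_eq_of_notMem hi]
  ring

lemma mExt_piecewise_one (f : Finset X → ℝ) (x : X → ℝ) (D : Finset X) :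
    mExt f (D.piecewise 1 x) = mExt (fun S => f (S ∪ D)) x := by
  induction D using Finset.induction_on generalizing f with
  | empty => simp
  | insert i D _ ih =>
    rw [piecewise_insert, mExt_update, ih]
    simp

lemma mExt_piecewise_zero (f : Finset X → ℝ) (x : X → ℝ) (D : Finset X) :
    mExt f (D.piecewise 0 x) = mExt (fun S => f (S \ D)) x := by
  induction D using Finset.induction_on generalizing f with
  | empty => simp
  | insert i D _ ih =>
    rw [piecewise_insert, mExt_update, ih, ih]
    simp [sdiff_insert]

/-- Sampling a block of coordinates independently is at least as good as sampling it as a whole. -/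
lemma Submodular.le_mExt_piecewise_const {f : Finset X → ℝ} (hf : Submodular f) {x : X → ℝ}
    (hx : ∀ i, x i ∈ Set.Icc (0 : ℝ) 1) {t : ℝ} (ht : t ∈ Set.Icc (0 : ℝ) 1) (D : Finset X) :
    t * mExt (fun S => f (S ∪ D)) x + (1 - t) * mExt (fun S => f (S \ D)) x ≤
      mExt f (D.piecewise (fun _ => t) x) := by
  induction D using Finset.induction_on generalizing f with
  | empty =>
    simp only [union_empty, sdiff_empty, piecewise_empty]
    linarith
  | insert i D hi ih =>
    rw [piecewise_insert, mExt_update]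
    have hins := ih (hf.comp_insert i)
    have hera := ih (hf.comp_erase i)
    have hcross : mExt (fun S => f (S ∪ insert i D)) x + mExt (fun S => f (S \ insert i D)) x ≤
        mExt (fun S => f (insert i (S \ D))) x + mExt (fun S => f ((S ∪ D).erase i)) x := by
      rw [← mExt_add, ← mExt_add]
      refine mExt_le_mExt (fun S => ?_) hx
      convert hf (insert i (S \ D)) ((S ∪ D).erase i) using 3
      · ext j
        simp only [mem_union, mem_insert, mem_sdiff, mem_erase]
        tauto
      · ext j
        by_cases hj : j = i
        · simp [hj]
        · simp only [mem_inter, mem_union, mem_insert, mem_sdiff, mem_erase]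
          tauto
    simp only [union_insert, sdiff_insert] at hcross ⊢
    nlinarith [mul_le_mul_of_nonneg_left hins ht.1,
      mul_le_mul_of_nonneg_left hera (sub_nonneg.2 ht.2),
      mul_le_mul_of_nonneg_left hcross (mul_nonneg ht.1 (sub_nonneg.2 ht.2))]

lemma Submodular.le_mExt_piecewise_const_of_eq_zero {f : Finset X → ℝ} (hf : Submodular f)
    {x : X → ℝ} (hx : ∀ i, x i ∈ Set.Icc (0 : ℝ) 1) {t : ℝ} (ht : t ∈ Set.Icc (0 : ℝ) 1)
    {D : Finset X} (hD : ∀ i ∈ D, x i = 0) :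
    t * mExt (fun S => f (S ∪ D)) x + (1 - t) * mExt f x ≤
      mExt f (D.piecewise (fun _ => t) x) := by
  have hpw : D.piecewise (0 : X → ℝ) x = x := by
    ext i
    by_cases hi : i ∈ D <;> simp [hi, hD]
  have h := hf.le_mExt_piecewise_const hx ht D
  rwa [← mExt_piecewise_zero, hpw] at h

/-- Lower bound on the multilinear extension at a vector with three constant blocks. -/
lemma Submodular.le_mExt_three_blocks {f : Finset X → ℝ} (hf : Submodular f)
    {D₁ D₂ D₃ : Finset X} (h₁₂ : Disjoint D₁ D₂) (h₁₃ : Disjoint D₁ D₃) (h₂₃ : Disjoint D₂ D₃)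
    {a b c : ℝ} (ha : a ∈ Set.Icc (0 : ℝ) 1) (hb : b ∈ Set.Icc (0 : ℝ) 1)
    (hc : c ∈ Set.Icc (0 : ℝ) 1) :
    a * (b * (c * f (D₃ ∪ D₂ ∪ D₁) + (1 - c) * f (D₂ ∪ D₁)) +
        (1 - b) * (c * f (D₃ ∪ D₁) + (1 - c) * f D₁)) +
      (1 - a) * (b * (c * f (D₃ ∪ D₂) + (1 - c) * f D₂) +
        (1 - b) * (c * f D₃ + (1 - c) * f ∅)) ≤
      mExt f (D₁.piecewise (fun _ => a) (D₂.piecewise (fun _ => b)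
        (D₃.piecewise (fun _ => c) 0))) := by
  have hx₀ : ∀ i, (0 : X → ℝ) i ∈ Set.Icc (0 : ℝ) 1 := fun i => by simp
  have hx₃ := piecewise_const_mem_Icc hx₀ hc D₃
  have hx₂ := piecewise_const_mem_Icc hx₃ hb D₂
  have one_block : ∀ {g : Finset X → ℝ}, Submodular g →
      c * g D₃ + (1 - c) * g ∅ ≤ mExt g (D₃.piecewise (fun _ => c) 0) := by
    intro g hg
    simpa [mExt_zero] using
      hg.le_mExt_piecewise_const_of_eq_zero hx₀ hc (D := D₃) (fun _ _ => rfl)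
  have two_blocks : ∀ {g : Finset X → ℝ}, Submodular g →
      b * (c * g (D₃ ∪ D₂) + (1 - c) * g D₂) + (1 - b) * (c * g D₃ + (1 - c) * g ∅) ≤
        mExt g (D₂.piecewise (fun _ => b) (D₃.piecewise (fun _ => c) 0)) := by
    intro g hg
    refine le_trans (add_le_add (mul_le_mul_of_nonneg_left ?_ hb.1)
      (mul_le_mul_of_nonneg_left (one_block hg) (sub_nonneg.2 hb.2)))
      (hg.le_mExt_piecewise_const_of_eq_zero hx₃ hb (D := D₂) ?_)
    · simpa using one_block (hg.comp_union D₂)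
    · intro i hi
      simp [disjoint_left.1 h₂₃ hi]
  refine le_trans (add_le_add (mul_le_mul_of_nonneg_left ?_ ha.1)
    (mul_le_mul_of_nonneg_left (two_blocks hf) (sub_nonneg.2 ha.2)))
    (hf.le_mExt_piecewise_const_of_eq_zero hx₂ ha (D := D₁) ?_)
  · simpa using two_blocks (hf.comp_union D₁)
  · intro i hi
    simp [disjoint_left.1 h₁₂ hi, disjoint_left.1 h₁₃ hi]

lemma Submodular.mExt_piecewise_one_le {f : Finset X → ℝ} (hf : Submodular f) {x : X → ℝ}
    (hx : ∀ i, x i ∈ Set.Icc (0 : ℝ) 1) {D : Finset X}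
    (hD : ∀ i ∈ D, mExt f (update x i 1) ≤ mExt f x) :
    mExt f (D.piecewise 1 x) ≤ mExt f x := by
  induction D using Finset.induction_on with
  | empty => simp
  | insert i D hi ih =>
    have hDle := ih fun j hj => hD j (mem_insert_of_mem hj)
    have hile := hD i (mem_insert_self i D)
    rw [mExt_piecewise_one] at hDle ⊢
    rw [mExt_update] at hile
    have hcross : mExt (fun S => f (S ∪ insert i D)) x + mExt f x ≤
        mExt (fun S => f (insert i S)) x + mExt (fun S => f (S ∪ D)) x := by
      rw [← mExt_add, ← mExt_add]
      refine mExt_le_mExt (fun S => ?_) hx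
      convert hf (insert i S) (S ∪ D) using 3
      · ext j
        simp only [mem_union, mem_insert]
        tauto
      · ext j
        by_cases hj : j = i
        · simp [hj, hi]
        · simp only [mem_inter, mem_union, mem_insert]
          tauto
    linarith

lemma Submodular.mExt_piecewise_zero_le {f : Finset X → ℝ} (hf : Submodular f) {x : X → ℝ}
    (hx : ∀ i, x i ∈ Set.Icc (0 : ℝ) 1) {D : Finset X}
    (hD : ∀ i ∈ D, mExt f (update x i 0) ≤ mExt f x) :
    mExt f (D.piecewise 0 x) ≤ mExt f x := by
  induction D using Finset.induction_on with
  | empty => simp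
  | insert i D hi ih =>
    have hDle := ih fun j hj => hD j (mem_insert_of_mem hj)
    have hile := hD i (mem_insert_self i D)
    rw [mExt_piecewise_zero] at hDle ⊢
    rw [mExt_update] at hile
    have hcross : mExt f x + mExt (fun S => f (S \ insert i D)) x ≤
        mExt (fun S => f (S.erase i)) x + mExt (fun S => f (S \ D)) x := by
      rw [← mExt_add, ← mExt_add]
      refine mExt_le_mExt (fun S => ?_) hx
      convert hf (S.erase i) (S \ D) using 3
      · ext j
        by_cases hj : j = i
        · simp [hj, hi]
        · simp only [mem_union, mem_sdiff, mem_erase]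
          tauto
      · ext j
        simp only [mem_inter, mem_insert, mem_sdiff, mem_erase]
        tauto
    linarith

end MultilinearExtension

/-- Local optimum quality bound: if `OPT = 1`, `q ∈ [1/3, 1/(1+√2)]`, `p = 1-q` and `A` is
a local optimum, then `F(x_p(A)) ≥ (1-q²)/2 - q(1-2q)β` where `β = max(f(A), f(X\A))`. -/
theorem local_optimum_quality_bound
    {X : Type*} [Fintype X] [DecidableEq X] (f : Finset X → ℝ)
    (hf0 : ∀ S, 0 ≤ f S) (hf : Submodular f)
    (hOPT : IsGreatest (Set.range f) 1)
    (q : ℝ) (hq : q ∈ Set.Icc (1 / 3 : ℝ) (1 / (1 + Real.sqrt 2))) (A : Finset X)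
    (hloc : ∀ i : X, mExt f (xp (1 - q) (symmDiff A {i})) ≤ mExt f (xp (1 - q) A)) :
    (1 - q ^ 2) / 2 - q * (1 - 2 * q) * max (f A) (f Aᶜ) ≤ mExt f (xp (1 - q) A) := by
  obtain ⟨⟨C, hC⟩, -⟩ := hOPT
  have hq' : q ^ 2 + 2 * q ≤ 1 := by
    have hsq := Real.sq_sqrt (zero_le_two : (0 : ℝ) ≤ 2)
    have hs0 := Real.sqrt_nonneg 2
    have hle : q ≤ √2 - 1 := hq.2.trans_eq (by
      rw [div_eq_iff (by positivity)]
      nlinarith)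
    nlinarith [hq.1]
  have hq1 : q < 1 / 2 := by nlinarith [hq.1]
  have hqI : q ∈ Set.Icc (0 : ℝ) 1 := ⟨by linarith [hq.1], by linarith⟩
  have hpI : 1 - q ∈ Set.Icc (0 : ℝ) 1 := ⟨by linarith, by linarith [hq.1]⟩
  have hx : ∀ i, xp (1 - q) A i ∈ Set.Icc (0 : ℝ) 1 := by
    intro i
    by_cases hi : i ∈ A <;> simp only [xp, hi, if_true, if_false, sub_sub_cancel, hqI, hpI]
  have hflip : ∀ i, (1 - 2 * xp (1 - q) A i) * (mExt f (Function.update (xp (1 - q) A) i 1) -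
      mExt f (Function.update (xp (1 - q) A) i 0)) ≤ 0 := by
    intro i
    have h := hloc i
    rw [xp_symmDiff_singleton] at h
    nth_rewrite 3 [← Function.update_eq_self i (xp (1 - q) A)] at h
    rw [mExt_update, mExt_update] at h
    rw [mExt_update, mExt_update]
    linarith
  have hself : ∀ i, mExt f (xp (1 - q) A) =
      xp (1 - q) A i * mExt f (Function.update (xp (1 - q) A) i 1) +
        (1 - xp (1 - q) A i) * mExt f (Function.update (xp (1 - q) A) i 0) := by
    intro i
    nth_rewrite 1 [← Function.update_eq_self i (xp (1 - q) A)]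
    simp only [mExt_update]
    ring
  have hup : mExt f ((Aᶜ ∩ C).piecewise 1 (xp (1 - q) A)) ≤ mExt f (xp (1 - q) A) := by
    refine hf.mExt_piecewise_one_le hx fun i hi => ?_
    have hiA : i ∉ A := by simp_all
    have h := hflip i
    rw [hself i]
    simp only [xp, hiA, if_false] at h ⊢
    nlinarith
  have hdown : mExt f ((A \ C).piecewise 0 (xp (1 - q) A)) ≤ mExt f (xp (1 - q) A) := by
    refine hf.mExt_piecewise_zero_le hx fun i hi => ?_
    have hiA : i ∈ A := by simp_all
    have h := hflip i
    rw [hself i]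
    simp only [xp, hiA, if_true] at h ⊢
    nlinarith
  have hupeq : (Aᶜ ∩ C).piecewise (1 : X → ℝ) (xp (1 - q) A) = (Aᶜ ∩ C).piecewise (1 : X → ℝ)
      ((Aᶜ \ C).piecewise (fun _ => q) ((A ∩ C).piecewise (fun _ => 1 - q)
        ((A \ C).piecewise (fun _ => 1 - q) 0))) := by
    ext i
    by_cases hiA : i ∈ A <;> by_cases hiC : i ∈ C <;> simp [Finset.piecewise, xp, hiA, hiC]
  have hdowneq : (A \ C).piecewise (0 : X → ℝ) (xp (1 - q) A) =
      (Aᶜ ∩ C).piecewise (fun _ => q) ((Aᶜ \ C).piecewise (fun _ => q)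
        ((A ∩ C).piecewise (fun _ => 1 - q) 0)) := by
    ext i
    by_cases hiA : i ∈ A <;> by_cases hiC : i ∈ C <;> simp [Finset.piecewise, xp, hiA, hiC]
  have h₁₂ : Disjoint (A \ C) (A ∩ C) := Finset.disjoint_sdiff_inter A C
  have h₁₃ : Disjoint (A \ C) (Aᶜ \ C) :=
    disjoint_compl_right.mono Finset.sdiff_subset Finset.sdiff_subset
  have h₁₄ : Disjoint (A \ C) (Aᶜ ∩ C) :=
    disjoint_compl_right.mono Finset.sdiff_subset Finset.inter_subset_left
  have h₂₃ : Disjoint (A ∩ C) (Aᶜ \ C) :=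
    disjoint_compl_right.mono Finset.inter_subset_left Finset.sdiff_subset
  have h₂₄ : Disjoint (A ∩ C) (Aᶜ ∩ C) :=
    disjoint_compl_right.mono Finset.inter_subset_left Finset.inter_subset_left
  have h₃₄ : Disjoint (Aᶜ \ C) (Aᶜ ∩ C) := Finset.disjoint_sdiff_inter Aᶜ C
  rw [hupeq, mExt_piecewise_one] at hup
  rw [hdowneq] at hdown
  have lower_up := ((hf.comp_union (Aᶜ ∩ C)).le_mExt_three_blocks h₂₃.symm h₁₃.symm h₁₂.symm
    hqI hpI hpI).trans hup
  have lower_down := (hf.le_mExt_three_blocks h₃₄.symm h₂₄.symm h₂₃.symm hqI hqI hpI).trans hdown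
  have hfour := hf.four_blocks_bound hf0 h₁₂ h₁₃ h₁₄ h₂₃ h₂₄ h₃₄ hq.1 hq'
  have hA : A \ C ∪ A ∩ C = A := Finset.sdiff_union_inter A C
  have hAc : Aᶜ \ C ∪ Aᶜ ∩ C = Aᶜ := Finset.sdiff_union_inter Aᶜ C
  have hCeq : A ∩ C ∪ Aᶜ ∩ C = C := by
    rw [← Finset.union_inter_distrib_right, Finset.union_compl, Finset.univ_inter]
  simp only [sub_sub_cancel, Finset.empty_union] at lower_up lower_down
  rw [hA, hCeq, hC] at hfour
  rw [hCeq, hC] at lower_up lower_down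
  rw [hA] at lower_up
  rw [hAc] at hfour lower_up lower_down
  linarith
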